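/- arXiv:2008.00190 — 3 statements merged into one kernel-verified Lean document; each statement's English description precedes it below -/
import Mathlib

section
/- Suppose y^n ∈ 𝒴^n satisfies |P_{y^n}(k) − p̄(y_k|x₁)| ≤ ε for all k, the training vector ŷ₁ ∈ 𝒴^{nt} satisfies |P_{ŷ₁}(k) − p̄(y_k|x₁)| ≤ ε·t^{−1/3} for all k, and for every label index i ≠ 1 the training vector ŷ_i ∈ 𝒴^{nt} satisfies ε < ‖P_{ŷ_i} − P̄₁‖_r / ((2 + t^{−1/3})·K^{1/r}). Then for every i ≠ 1, ‖P_{y^n} − P_{ŷ₁}‖_r < ‖P_{y^n} − P_{ŷ_i}‖_r; that is, the nearest-empirical-distribution classifier assigns label x₁ to y^n. -/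
open Finset

/-- Empirical distribution of a vector `v : Fin N → Fin K`. -/
noncomputable def empDist {K N : ℕ} (v : Fin N → Fin K) (k : Fin K) : ℝ :=
  ((Finset.univ.filter (fun j => v j = k)).card : ℝ) / N

/-- The ℓ^r norm on ℝ^K. -/
noncomputable def lpNorm {K : ℕ} (r : ℝ) (u : Fin K → ℝ) : ℝ :=
  (∑ k, |u k| ^ r) ^ (1 / r)

theorem lpNorm_bound_aux {K : ℕ} (r : ℝ) (hr : 1 ≤ r) (u : Fin K → ℝ) (c : ℝ) (hc : 0 ≤ c)
    (h : ∀ k, |u k| ≤ c) : lpNorm r u ≤ c * (K : ℝ) ^ (1 / r) := by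
  have hr0 : 0 < r := by linarith
  have h1 : ∑ k, |u k| ^ r ≤ (K : ℝ) * c ^ r := by
    calc ∑ k, |u k| ^ r ≤ ∑ _k : Fin K, c ^ r :=
          Finset.sum_le_sum fun k _ => Real.rpow_le_rpow (abs_nonneg _) (h k) hr0.le
      _ = (K : ℝ) * c ^ r := by simp
  have h2 : (∑ k, |u k| ^ r) ^ (1 / r) ≤ ((K : ℝ) * c ^ r) ^ (1 / r) :=
    Real.rpow_le_rpow (Finset.sum_nonneg fun k _ => Real.rpow_nonneg (abs_nonneg _) _) h1
      (by positivity)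
  rw [Real.mul_rpow (by positivity) (by positivity), ← Real.rpow_mul hc,
    mul_one_div_cancel hr0.ne', Real.rpow_one, mul_comm] at h2
  exact h2

theorem stmt_2 {K n t M : ℕ} (hK : 1 ≤ K) (hn : 1 ≤ n) (ht : 1 ≤ t) (hM : 2 ≤ M)
    (r : ℝ) (hr : 1 ≤ r) (ε : ℝ) (hε : 0 < ε)
    (p : Fin n → Fin K → ℝ)
    (hp0 : ∀ i k, 0 ≤ p i k) (hp1 : ∀ i, ∑ k, p i k = 1)
    (pbar : Fin K → ℝ) (hpbar : ∀ k, pbar k = (∑ i, p i k) / n)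
    (x1 : Fin M)                                -- the true label
    (y : Fin n → Fin K)                         -- the observed vector
    (yh : Fin M → Fin (n * t) → Fin K)          -- one training vector per label
    (hy : ∀ k, |empDist y k - pbar k| ≤ ε)
    (hyh1 : ∀ k, |empDist (yh x1) k - pbar k| ≤ ε * (t : ℝ) ^ (-(1/3 : ℝ)))
    (hsep : ∀ i, i ≠ x1 →
      ε < lpNorm r (fun k => empDist (yh i) k - pbar k) /
            ((2 + (t : ℝ) ^ (-(1/3 : ℝ))) * (K : ℝ) ^ (1 / r))) :
    ∀ i, i ≠ x1 →
      lpNorm r (fun k => empDist y k - empDist (yh x1) k) <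
        lpNorm r (fun k => empDist y k - empDist (yh i) k) := by
  intro i hi
  have hs : 0 ≤ (t : ℝ) ^ (-(1/3 : ℝ)) := by positivity
  have hKp : 0 < (K : ℝ) ^ (1 / r) := Real.rpow_pos_of_pos (by exact_mod_cast hK) _
  have h0 := hsep i hi
  generalize (t : ℝ) ^ (-(1/3 : ℝ)) = s at *
  rw [lt_div_iff₀ (by positivity)] at h0
  have hA := lpNorm_bound_aux r hr (fun k => empDist y k - empDist (yh x1) k) (ε + ε * s)
    (by positivity) (fun k => by
      have h1 := abs_le.1 (hy k)
      have h2 := abs_le.1 (hyh1 k)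
      exact abs_le.2 ⟨by linarith [h1.1, h2.2], by linarith [h1.2, h2.1]⟩)
  have hB := lpNorm_bound_aux r hr (fun k => empDist y k - pbar k) ε hε.le hy
  have hC : lpNorm r (fun k => empDist (yh i) k - pbar k) ≤
      lpNorm r (fun k => empDist y k - empDist (yh i) k) +
      lpNorm r (fun k => empDist y k - pbar k) := by
    have h := Real.Lp_add_le Finset.univ (fun k => empDist (yh i) k - empDist y k)
      (fun k => empDist y k - pbar k) hr
    simp only [sub_add_sub_cancel] at h
    unfold lpNorm
    simpa only [abs_sub_comm (empDist y _) (empDist (yh i) _)] using h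
  linarith
end

section
/- Consider the following random model: the observed vector Y^n = (Y₁,…,Y_n) has independent coordinates with Y_i distributed according to p_i(·|x₁); for each label l ∈ {1,…,M}, the training vector Ŷ_l ∈ 𝒴^{nt} has independent coordinates where, writing j = n·a + i with 0 ≤ a ≤ t−1 and 1 ≤ i ≤ n, the j-th coordinate of Ŷ_l is distributed according to p_i(·|x_l); and Y^n, Ŷ₁,…,Ŷ_M are mutually independent. Let ε = min_{i ≠ j} ‖P̄_i − P̄_j‖_r / (2·(1 + t^{−1/3})·K^{1/r}) and assume ε > 0. Then the probability that there exists some i ≠ 1 with ‖P_{Y^n} − P_{Ŷ_i}‖_r ≤ ‖P_{Y^n} − P_{Ŷ₁}‖_r (i.e., that the nearest-empirical-distribution classifier fails to strictly prefer the true label x₁) is at most 2K·e^{−2nε²} + 2MK·e^{−2n·t^{1/3}·ε²}. -/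
open MeasureTheory ProbabilityTheory Finset

lemma hoeff_emp {Ω : Type*} [MeasurableSpace Ω] (μ : Measure Ω) [IsProbabilityMeasure μ]
    {K N : ℕ} (hN : 0 < N) (Z : Fin N → Ω → Fin K) (hZ : ∀ j, Measurable (Z j))
    (hi : iIndepFun Z μ) (k : Fin K) (q : Fin N → ℝ) (hq0 : ∀ j, 0 ≤ q j)
    (hq : ∀ j, μ {ω | Z j ω = k} = ENNReal.ofReal (q j)) (ε : ℝ) (hε : 0 ≤ ε) :
    μ.real {ω | ε ≤ |empDist (fun j => Z j ω) k - (∑ j, q j) / N|}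
      ≤ 2 * Real.exp (-2 * N * ε ^ 2) := by
  have hN' : (0:ℝ) < N := by exact_mod_cast hN
  let g : Fin K → ℝ := fun y => if y = k then 1 else 0
  let X : Fin N → Ω → ℝ := fun j ω => g (Z j ω) - q j
  have hg : Measurable g := measurable_from_top
  have hint : ∀ j, ∫ ω, g (Z j ω) ∂μ = q j := by
    intro j
    have hs : MeasurableSet {ω | Z j ω = k} := hZ j (measurableSet_singleton k)
    have : (fun ω => g (Z j ω)) = Set.indicator {ω | Z j ω = k} (fun _ => (1:ℝ)) := by
      ext ω
      simp [g, Set.indicator_apply]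
    rw [this, integral_indicator_const _ hs]
    simp [Measure.real, hq, hq0]
  have hX : iIndepFun X μ := by
    exact hi.comp (fun j y => g y - q j) (fun j => measurable_from_top)
  have hsub : ∀ j, HasSubgaussianMGF (X j) ((‖(1:ℝ) - 0‖₊ / 2) ^ 2) μ := by
    intro j
    have := hasSubgaussianMGF_of_mem_Icc (μ := μ) (X := fun ω => g (Z j ω)) (a := 0) (b := 1)
      (hg.comp (hZ j)).aemeasurable (Filter.Eventually.of_forall fun ω => by
        simp only [g]; split_ifs <;> simp)
    rw [hint] at this
    exact this
  have hXn : iIndepFun (fun j => - X j) μ := by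
    exact hX.comp (fun j y => - y) (fun j => measurable_neg)
  have h1 := HasSubgaussianMGF.measure_sum_ge_le_of_iIndepFun hX (s := Finset.univ)
    (fun j _ => hsub j) (ε := N * ε) (by positivity)
  have h2 := HasSubgaussianMGF.measure_sum_ge_le_of_iIndepFun hXn (s := Finset.univ)
    (fun j _ => (hsub j).neg) (ε := N * ε) (by positivity)
  have hexp : -(N * ε) ^ 2 / (2 * ((∑ _j : Fin N, (‖(1:ℝ) - 0‖₊ / 2) ^ 2 : NNReal) : ℝ))
      = -2 * N * ε ^ 2 := by
    simp
    field_simp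
  rw [hexp] at h1 h2
  have hsum : ∀ ω, empDist (fun j => Z j ω) k - (∑ j, q j) / N = (∑ j, X j ω) / N := by
    intro ω
    simp only [empDist, X, g, Finset.sum_sub_distrib, Finset.sum_boole]
    ring
  have hsubset : {ω | ε ≤ |empDist (fun j => Z j ω) k - (∑ j, q j) / N|} ⊆
      {ω | N * ε ≤ ∑ j, X j ω} ∪ {ω | N * ε ≤ ∑ j, (- X j) ω} := by
    intro ω hω
    simp only [Set.mem_ofPred_eq, hsum, le_abs] at hω
    simp only [Set.mem_union, Set.mem_ofPred_eq, Pi.neg_apply, Finset.sum_neg_distrib]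
    rcases hω with h | h
    · left; rw [le_div_iff₀ hN'] at h; linarith
    · right; rw [← neg_div, le_div_iff₀ hN'] at h; linarith
  calc _ ≤ _ := measureReal_mono hsubset
    _ ≤ _ := measureReal_union_le _ _
    _ ≤ _ := by linarith

lemma lpNorm_add_le' {K : ℕ} {r : ℝ} (hr : 1 ≤ r) (u v w : Fin K → ℝ)
    (h : ∀ k, w k = u k + v k) : lpNorm r w ≤ lpNorm r u + lpNorm r v := by
  have : w = fun k => u k + v k := funext h
  subst this
  exact Real.Lp_add_le Finset.univ u v hr

lemma lpNorm_neg' {K : ℕ} {r : ℝ} (u v : Fin K → ℝ)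
    (h : ∀ k, v k = - u k) : lpNorm r v = lpNorm r u := by
  simp [_root_.lpNorm, h]

lemma lpNorm_lt' {K : ℕ} (hK : 1 ≤ K) {r : ℝ} (hr : 1 ≤ r) (u : Fin K → ℝ) (c : ℝ)
    (hc : 0 ≤ c) (h : ∀ k, |u k| < c) : lpNorm r u < (K : ℝ) ^ (1 / r) * c := by
  have hr0 : 0 < r := by linarith
  have : (K : ℝ) ^ (1 / r) * c = ((K:ℝ) * c ^ r) ^ (1 / r) := by
    rw [Real.mul_rpow (by positivity) (by positivity), ← Real.rpow_mul hc, mul_one_div_cancel hr0.ne',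
      Real.rpow_one]
  rw [this, _root_.lpNorm]
  apply Real.rpow_lt_rpow (Finset.sum_nonneg fun k _ => by positivity) _ (by positivity)
  have hne : (Finset.univ : Finset (Fin K)).Nonempty := ⟨⟨0, by omega⟩, by simp⟩
  calc ∑ k, |u k| ^ r < ∑ _k : Fin K, c ^ r :=
        Finset.sum_lt_sum_of_nonempty hne fun k _ => Real.rpow_lt_rpow (abs_nonneg _) (h k) hr0
    _ = K * c ^ r := by simp

lemma sum_mod' {n : ℕ} (hn : 0 < n) (t : ℕ) (f : Fin n → ℝ) :
    ∑ j : Fin (n * t), f ⟨(j : ℕ) % n, Nat.mod_lt _ hn⟩ = t * ∑ i, f i := by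
  rw [Fin.sum_univ_eq_sum_range (fun j => f ⟨j % n, Nat.mod_lt _ hn⟩) (n * t)]
  induction t with
  | zero => simp
  | succ t ih =>
    rw [Nat.mul_succ, Finset.sum_range_add, ih]
    have : ∑ x ∈ Finset.range n, f ⟨(n * t + x) % n, Nat.mod_lt _ hn⟩ = ∑ i, f i := by
      rw [← Fin.sum_univ_eq_sum_range (fun x => f ⟨(n * t + x) % n, Nat.mod_lt _ hn⟩) n]
      refine Finset.sum_congr rfl fun i _ => ?_
      congr 1
      ext
      simp [Nat.mod_eq_of_lt i.2]
    rw [this]; push_cast; ring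

theorem stmt_12 {Ω : Type*} [MeasurableSpace Ω] (μ : Measure Ω) [IsProbabilityMeasure μ]
    {K n t M : ℕ} (hK : 1 ≤ K) (hn : 0 < n) (ht : 1 ≤ t) (hM : 2 ≤ M)
    (r : ℝ) (hr : 1 ≤ r)
    (p : Fin M → Fin n → Fin K → ℝ)
    (hp0 : ∀ l i k, 0 ≤ p l i k) (hp1 : ∀ l i, ∑ k, p l i k = 1)
    (pbar : Fin M → Fin K → ℝ) (hpbar : ∀ l k, pbar l k = (∑ i, p l i k) / n)
    (x1 : Fin M)                               -- the true label
    (Y : Fin n → Ω → Fin K)                    -- the observed vector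
    (Yh : Fin M → Fin (n * t) → Ω → Fin K)     -- one random training vector per label
    (hYmeas : ∀ i, Measurable (Y i))
    (hYhmeas : ∀ l j, Measurable (Yh l j))
    -- `Y i` is distributed according to `p x1 i (·)`
    (hYdist : ∀ i k, μ {ω | Y i ω = k} = ENNReal.ofReal (p x1 i k))
    -- the `j`-th coordinate of the training vector for label `l`
    -- (with `j = n·a + i`, i.e. `i ≡ j mod n`) is distributed according to `p l i (·)`
    (hYhdist : ∀ l (j : Fin (n * t)) k,
      μ {ω | Yh l j ω = k} = ENNReal.ofReal (p l ⟨(j : ℕ) % n, Nat.mod_lt _ hn⟩ k))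
    -- all coordinates of `Y, Yh 1, …, Yh M` are mutually independent
    (hindep : iIndepFun
      (fun idx : Fin n ⊕ (Fin M × Fin (n * t)) =>
        Sum.elim Y (fun q => Yh q.1 q.2) idx) μ)
    (ε : ℝ)
    (hε : ε = ((Finset.univ : Finset (Fin M × Fin M)).filter (fun q => q.1 ≠ q.2)).inf'
      ⟨(⟨0, by omega⟩, ⟨1, by omega⟩), by simp [Fin.ext_iff]⟩
      (fun q => lpNorm r (fun k => pbar q.1 k - pbar q.2 k) /
        (2 * (1 + (t : ℝ) ^ (-(1/3 : ℝ))) * (K : ℝ) ^ (1 / r))))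
    (hεpos : 0 < ε) :
    (μ {ω | ∃ i, i ≠ x1 ∧
        lpNorm r (fun k => empDist (fun j => Y j ω) k - empDist (fun j => Yh i j ω) k) ≤
          lpNorm r (fun k => empDist (fun j => Y j ω) k -
            empDist (fun j => Yh x1 j ω) k)}).toReal ≤
      2 * K * Real.exp (-2 * n * ε ^ 2) +
        2 * M * K * Real.exp (-2 * n * (t : ℝ) ^ ((1:ℝ)/3) * ε ^ 2) := by
  have hn' : (0:ℝ) < n := by exact_mod_cast hn
  have ht' : (0:ℝ) < t := by exact_mod_cast ht
  set s : ℝ := (t : ℝ) ^ (-(1/3 : ℝ)) with hs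
  have hs0 : 0 < s := by positivity
  set κ : ℝ := (K : ℝ) ^ (1 / r) with hκ
  have hκ0 : 0 < κ := by
    have : (0:ℝ) < K := by exact_mod_cast hK
    positivity
  have hsep : ∀ i, i ≠ x1 → 2 * (1 + s) * κ * ε ≤ lpNorm r (fun k => pbar i k - pbar x1 k) := by
    intro i hi
    have h1 : ε ≤ lpNorm r (fun k => pbar i k - pbar x1 k) / (2 * (1 + s) * κ) := by
      rw [hε]
      exact Finset.inf'_le (b := (i, x1)) _ (by simp [hi])
    rw [le_div_iff₀ (by positivity)] at h1
    linarith
  let A : Fin K → Set Ω := fun k => {ω | ε ≤ |empDist (fun j => Y j ω) k - pbar x1 k|}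
  let B : Fin M → Fin K → Set Ω := fun l k =>
    {ω | s * ε ≤ |empDist (fun j => Yh l j ω) k - pbar l k|}
  have hA : ∀ k, μ.real (A k) ≤ 2 * Real.exp (-2 * n * ε ^ 2) := by
    intro k
    have hi : iIndepFun Y μ := hindep.precomp (g := Sum.inl) Sum.inl_injective
    have := hoeff_emp μ hn Y hYmeas hi k (fun i => p x1 i k) (fun i => hp0 _ _ _)
      (fun i => hYdist i k) ε hεpos.le
    rw [← hpbar] at this
    exact this
  have hB : ∀ l k, μ.real (B l k) ≤ 2 * Real.exp (-2 * n * (t : ℝ) ^ ((1:ℝ)/3) * ε ^ 2) := by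
    intro l k
    have hi : iIndepFun (Yh l) μ := hindep.precomp (g := fun j => Sum.inr (l, j))
      (fun a b h => by simpa using h)
    have := hoeff_emp μ (Nat.mul_pos hn ht) (Yh l) (hYhmeas l) hi k
      (fun j => p l ⟨(j : ℕ) % n, Nat.mod_lt _ hn⟩ k) (fun i => hp0 _ _ _)
      (fun j => hYhdist l j k) (s * ε) (by positivity)
    have e1 : (∑ j : Fin (n * t), p l ⟨(j : ℕ) % n, Nat.mod_lt _ hn⟩ k) / ((n * t : ℕ) : ℝ)
        = pbar l k := by
      rw [sum_mod' hn t (fun i => p l i k), hpbar]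
      push_cast
      field_simp
    have e2 : -2 * ((n * t : ℕ) : ℝ) * (s * ε) ^ 2 = -2 * n * (t : ℝ) ^ ((1:ℝ)/3) * ε ^ 2 := by
      have : (t : ℝ) ^ ((1:ℝ)/3) = t * s ^ 2 := by
        rw [hs, ← Real.rpow_natCast, ← Real.rpow_mul ht'.le]
        nth_rewrite 2 [← Real.rpow_one (t:ℝ)]
        rw [← Real.rpow_add ht']
        norm_num
      rw [this]; push_cast; ring
    rw [e1, e2] at this
    exact this
  have hsubset : {ω | ∃ i, i ≠ x1 ∧
        lpNorm r (fun k => empDist (fun j => Y j ω) k - empDist (fun j => Yh i j ω) k) ≤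
          lpNorm r (fun k => empDist (fun j => Y j ω) k -
            empDist (fun j => Yh x1 j ω) k)} ⊆ (⋃ k, A k) ∪ ⋃ q : Fin M × Fin K, B q.1 q.2 := by
    rintro ω ⟨i, hi, hle⟩
    by_contra hcon
    simp only [Set.mem_union, Set.mem_iUnion, not_or, not_exists, Prod.forall, A, B,
      Set.mem_ofPred_eq, not_le] at hcon
    obtain ⟨hcA, hcB⟩ := hcon
    have a := lpNorm_lt' hK hr _ ε hεpos.le hcA
    have b := fun l => lpNorm_lt' hK hr _ (s * ε) (by positivity) (hcB l)
    have b1 := b x1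
    have bi := b i
    have t1 := lpNorm_add_le' hr (fun k => empDist (fun j => Y j ω) k - pbar x1 k)
      (fun k => pbar x1 k - empDist (fun j => Yh x1 j ω) k)
      (fun k => empDist (fun j => Y j ω) k - empDist (fun j => Yh x1 j ω) k) (fun k => by ring)
    have n1 := lpNorm_neg' (r := r) (fun k => empDist (fun j => Yh x1 j ω) k - pbar x1 k)
      (fun k => pbar x1 k - empDist (fun j => Yh x1 j ω) k) (fun k => by ring)
    have t2 := lpNorm_add_le' hr (fun k => pbar i k - empDist (fun j => Yh i j ω) k)
      (fun k => empDist (fun j => Yh i j ω) k - pbar x1 k)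
      (fun k => pbar i k - pbar x1 k) (fun k => by ring)
    have n2 := lpNorm_neg' (r := r) (fun k => empDist (fun j => Yh i j ω) k - pbar i k)
      (fun k => pbar i k - empDist (fun j => Yh i j ω) k) (fun k => by ring)
    have t3 := lpNorm_add_le' hr (fun k => empDist (fun j => Yh i j ω) k - empDist (fun j => Y j ω) k)
      (fun k => empDist (fun j => Y j ω) k - pbar x1 k)
      (fun k => empDist (fun j => Yh i j ω) k - pbar x1 k) (fun k => by ring)
    have n3 := lpNorm_neg' (r := r)
      (fun k => empDist (fun j => Y j ω) k - empDist (fun j => Yh i j ω) k)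
      (fun k => empDist (fun j => Yh i j ω) k - empDist (fun j => Y j ω) k) (fun k => by ring)
    have hsi := hsep i hi
    rw [← hκ] at a b1 bi
    have : 2 * (1 + s) * κ * ε = 2 * (κ * ε) + 2 * (κ * (s * ε)) := by ring
    linarith
  change μ.real _ ≤ _
  calc _ ≤ _ := measureReal_mono hsubset
    _ ≤ _ := measureReal_union_le _ _
    _ ≤ (∑ k, μ.real (A k)) + ∑ q : Fin M × Fin K, μ.real (B q.1 q.2) :=
        add_le_add (measureReal_iUnion_fintype_le _) (measureReal_iUnion_fintype_le _)
    _ ≤ (∑ _k : Fin K, 2 * Real.exp (-2 * n * ε ^ 2)) +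
        ∑ _q : Fin M × Fin K, 2 * Real.exp (-2 * n * (t : ℝ) ^ ((1:ℝ)/3) * ε ^ 2) :=
        add_le_add (Finset.sum_le_sum fun k _ => hA k) (Finset.sum_le_sum fun q _ => hB _ _)
    _ = _ := by
        simp only [Finset.sum_const, Finset.card_univ, Fintype.card_prod, Fintype.card_fin,
          nsmul_eq_mul]
        push_cast
        ring
end

section
/- (Corollary 1.) Let the observed vector Y^n = (Y₁,…,Y_n) have independent coordinates with Y_i distributed according to p_i(·|x₁). Let ε = min_{i ≠ j} ‖P̄_i − P̄_j‖_r / (2·K^{1/r}) and assume ε > 0. Then the probability that there exists some j ≠ 1 with ‖P_{Y^n} − P̄_j‖_r ≤ ‖P_{Y^n} − P̄₁‖_r (i.e., that the classifier which assigns the label l minimizing ‖P_{Y^n} − P̄_l‖_r fails to strictly prefer the true label x₁) is at most 2K·e^{−2nε²}. -/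
open MeasureTheory ProbabilityTheory Finset

lemma aux_hoeff {Ω : Type*} [MeasurableSpace Ω] (μ : Measure Ω) [IsProbabilityMeasure μ]
    {K n : ℕ} (hn : 1 ≤ n) (q : Fin n → ℝ) (hq : ∀ i, 0 ≤ q i) (k : Fin K)
    (Y : Fin n → Ω → Fin K) (hYmeas : ∀ i, Measurable (Y i))
    (hYdist : ∀ i, μ {ω | Y i ω = k} = ENNReal.ofReal (q i))
    (hindep : iIndepFun Y μ) (ε : ℝ) (hε : 0 < ε) :
    μ.real {ω | ε ≤ |empDist (fun i => Y i ω) k - (∑ i, q i) / n|}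
      ≤ 2 * Real.exp (-2 * n * ε ^ 2) := by
  have hn0 : (0 : ℝ) < n := by exact_mod_cast hn
  let g : Fin n → Fin K → ℝ := fun i y => (if y = k then (1 : ℝ) else 0) - q i
  let X : Fin n → Ω → ℝ := fun i ω => g i (Y i ω)
  have hXi : iIndepFun X μ := hindep.comp g (fun i => measurable_of_countable _)
  have hXs : ∀ i, HasSubgaussianMGF (X i) (1 / 4) μ := by
    intro i
    have hm : Measurable (fun ω => if Y i ω = k then (1 : ℝ) else 0) :=
      (measurable_of_countable (fun y : Fin K => if y = k then (1 : ℝ) else 0)).comp (hYmeas i)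
    have h := hasSubgaussianMGF_of_mem_Icc (μ := μ) (a := 0) (b := 1) hm.aemeasurable
      (Filter.Eventually.of_forall fun ω => by
        split_ifs <;> simp)
    have hint : ∫ ω, (if Y i ω = k then (1 : ℝ) else 0) ∂μ = q i := by
      have hs : MeasurableSet {ω | Y i ω = k} := hYmeas i (measurableSet_singleton k)
      have : (fun ω => if Y i ω = k then (1 : ℝ) else 0)
          = Set.indicator {ω | Y i ω = k} 1 := by
        ext ω; simp [Set.indicator]
      rw [this, integral_indicator_one hs, Measure.real, hYdist, ENNReal.toReal_ofReal (hq i)]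
    rw [hint] at h
    convert h using 1
    ext; norm_num
  have hXn : ∀ i, HasSubgaussianMGF (-X i) (1 / 4) μ := fun i => (hXs i).neg
  have hXni : iIndepFun (fun i => -X i) μ :=
    hindep.comp (fun i y => - g i y) (fun i => measurable_of_countable _)
  have h1 := HasSubgaussianMGF.measure_sum_ge_le_of_iIndepFun hXi (s := Finset.univ)
    (fun i _ => hXs i) (ε := n * ε) (by positivity)
  have h2 := HasSubgaussianMGF.measure_sum_ge_le_of_iIndepFun hXni (s := Finset.univ)
    (fun i _ => hXn i) (ε := n * ε) (by positivity)
  have hexp : -((n : ℝ) * ε) ^ 2 / (2 * ((∑ i : Fin n, (1 / 4 : NNReal) : NNReal) : ℝ))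
      = -2 * n * ε ^ 2 := by
    simp; field_simp; norm_num
  rw [hexp] at h1 h2
  have hsum : ∀ ω, empDist (fun i => Y i ω) k - (∑ i, q i) / n = (∑ i, X i ω) / n := by
    intro ω
    simp [empDist, X, g, Finset.sum_sub_distrib, sub_div]
  calc _ ≤ μ.real ({ω | n * ε ≤ ∑ i, X i ω} ∪ {ω | n * ε ≤ ∑ i, (-X i) ω}) := by
        refine measureReal_mono ?_
        intro ω hω
        simp only [Set.mem_ofPred_eq, hsum, le_abs, ← neg_div, le_div_iff₀ hn0] at hω
        simp only [Set.mem_union, Set.mem_ofPred_eq, Pi.neg_apply, Finset.sum_neg_distrib]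
        rwa [mul_comm]
    _ ≤ _ := (measureReal_union_le _ _).trans (by linarith)

lemma aux_norm {K : ℕ} (hK : 1 ≤ K) (r : ℝ) (hr : 1 ≤ r) (P a b : Fin K → ℝ) (ε : ℝ)
    (hε : 0 < ε)
    (h1 : ε ≤ lpNorm r (fun k => a k - b k) / (2 * (K : ℝ) ^ (1 / r)))
    (h2 : lpNorm r (fun k => P k - b k) ≤ lpNorm r (fun k => P k - a k)) :
    ∃ k, ε ≤ |P k - a k| := by
  by_contra! hc
  have hr0 : 0 < r := by linarith
  have hK0 : (0 : ℝ) < K := by exact_mod_cast hK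
  have hKr : (0 : ℝ) < (K : ℝ) ^ (1 / r) := by positivity
  rw [le_div_iff₀ (by positivity)] at h1
  have tri := Real.Lp_add_le Finset.univ (fun k => P k - b k) (fun k => -(P k - a k)) hr
  have e1 : ∀ k, P k - b k + -(P k - a k) = a k - b k := fun k => by ring
  simp only [e1, abs_neg] at tri
  have hlt : lpNorm r (fun k => P k - a k) < ε * (K : ℝ) ^ (1 / r) := by
    have : ∑ k, |P k - a k| ^ r < K * ε ^ r := by
      calc _ < ∑ k : Fin K, ε ^ r := by
            refine Finset.sum_lt_sum_of_nonempty ⟨⟨0, hK⟩, by simp⟩ fun k _ => ?_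
            exact Real.rpow_lt_rpow (abs_nonneg _) (hc k) hr0
        _ = _ := by simp
    have h := Real.rpow_lt_rpow (Finset.sum_nonneg fun k _ => by positivity) this
      (show 0 < 1 / r by positivity)
    rw [Real.mul_rpow hK0.le (by positivity), ← Real.rpow_mul hε.le,
      mul_one_div_cancel hr0.ne', Real.rpow_one, mul_comm] at h
    exact h
  unfold _root_.lpNorm at h1 h2 hlt
  linarith

theorem stmt_14 {Ω : Type*} [MeasurableSpace Ω] (μ : Measure Ω) [IsProbabilityMeasure μ]
    {K n M : ℕ} (hK : 1 ≤ K) (hn : 1 ≤ n) (hM : 2 ≤ M)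
    (r : ℝ) (hr : 1 ≤ r)
    (p : Fin M → Fin n → Fin K → ℝ)
    (hp0 : ∀ l i k, 0 ≤ p l i k) (hp1 : ∀ l i, ∑ k, p l i k = 1)
    (pbar : Fin M → Fin K → ℝ) (hpbar : ∀ l k, pbar l k = (∑ i, p l i k) / n)
    (x1 : Fin M)                          -- the true label
    (Y : Fin n → Ω → Fin K)               -- the observed vector
    (hYmeas : ∀ i, Measurable (Y i))
    -- `Y i` is distributed according to `p x1 i (·)`
    (hYdist : ∀ i k, μ {ω | Y i ω = k} = ENNReal.ofReal (p x1 i k))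
    -- the `Y i` are independent
    (hindep : iIndepFun Y μ)
    (ε : ℝ)
    (hε : ε = ((Finset.univ : Finset (Fin M × Fin M)).filter (fun q => q.1 ≠ q.2)).inf'
      ⟨(⟨0, by omega⟩, ⟨1, by omega⟩), by simp [Fin.ext_iff]⟩
      (fun q => lpNorm r (fun k => pbar q.1 k - pbar q.2 k) / (2 * (K : ℝ) ^ (1 / r))))
    (hεpos : 0 < ε) :
    (μ {ω | ∃ j, j ≠ x1 ∧
        lpNorm r (fun k => empDist (fun i => Y i ω) k - pbar j k) ≤
          lpNorm r (fun k => empDist (fun i => Y i ω) k - pbar x1 k)}).toReal ≤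
      2 * K * Real.exp (-2 * n * ε ^ 2) := by
  have hsub : {ω | ∃ j, j ≠ x1 ∧
        lpNorm r (fun k => empDist (fun i => Y i ω) k - pbar j k) ≤
          lpNorm r (fun k => empDist (fun i => Y i ω) k - pbar x1 k)} ⊆
      ⋃ k : Fin K, {ω | ε ≤ |empDist (fun i => Y i ω) k - (∑ i, p x1 i k) / n|} := by
    rintro ω ⟨j, hj, hle⟩
    have h1 : ε ≤ lpNorm r (fun k => pbar x1 k - pbar j k) / (2 * (K : ℝ) ^ (1 / r)) := by
      rw [hε]
      exact Finset.inf'_le (fun q : Fin M × Fin M =>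
        lpNorm r (fun k => pbar q.1 k - pbar q.2 k) / (2 * (K : ℝ) ^ (1 / r)))
        (b := (x1, j)) (by simpa using hj.symm)
    obtain ⟨k, hk⟩ := aux_norm hK r hr _ _ _ ε hεpos h1 hle
    rw [hpbar] at hk
    exact Set.mem_iUnion.2 ⟨k, hk⟩
  calc _ ≤ μ.real (⋃ k : Fin K, {ω | ε ≤ |empDist (fun i => Y i ω) k - (∑ i, p x1 i k) / n|}) :=
        measureReal_mono hsub
    _ ≤ ∑ k : Fin K, μ.real {ω | ε ≤ |empDist (fun i => Y i ω) k - (∑ i, p x1 i k) / n|} :=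
        measureReal_iUnion_fintype_le _
    _ ≤ ∑ k : Fin K, 2 * Real.exp (-2 * n * ε ^ 2) :=
        Finset.sum_le_sum fun k _ => aux_hoeff μ hn (fun i => p x1 i k) (fun i => hp0 x1 i k) k Y
          hYmeas (fun i => hYdist i k) hindep ε hεpos
    _ = _ := by simp; ring
end
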